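/- arXiv:2603.20886 — 3 statements merged into one kernel-verified Lean document; each statement's English description precedes it below -/
import Mathlib

section
/- Let F be a field of characteristic zero, let m, n, t be natural numbers, and let M be an m × n matrix over F. Let ℓ, ℓ' : Fin t → F be two families that are each linearly independent over ℚ and whose ℚ-spans both equal the ℚ-span of the set of entries of M. Suppose N, N' : Fin t → (m × n matrices over ℚ) satisfy M = Σ_{i=1}^t ℓ_i · (N_i mapped entrywise into F) and M = Σ_{i=1}^t ℓ'_i · (N'_i mapped entrywise into F). Then the rank over K_t of Σ_{i=1}^t X_i · (N_i mapped entrywise into K_t) equals the rank over K_t of Σ_{i=1}^t X_i · (N'_i mapped entrywise into K_t). -/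
theorem Matrix.exists_eq_mul_of_rank {K m n : Type*} [Field K] [Fintype m] [Fintype n]
    (A : Matrix m n K) :
    ∃ (B : Matrix m (Fin A.rank) K) (C : Matrix (Fin A.rank) n K), A = B * C := by
  let b := Module.finBasisOfFinrankEq K (Submodule.span K (Set.range A.col))
    A.rank_eq_finrank_span_cols.symm
  let v (j : n) : Submodule.span K (Set.range A.col) :=
    ⟨A.col j, Submodule.subset_span ⟨j, rfl⟩⟩
  refine ⟨Matrix.of fun a k => (b k : m → K) a, Matrix.of fun k j => b.repr (v j) k, ?_⟩
  ext a j
  have h := congrArg (fun w : Submodule.span K (Set.range A.col) => (w : m → K) a)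
    (b.sum_repr (v j))
  simp only [Submodule.coe_sum, Submodule.coe_smul, Finset.sum_apply, Pi.smul_apply,
    smul_eq_mul] at h
  simp only [Matrix.mul_apply, Matrix.of_apply]
  rw [← (show (v j : m → K) a = A a j from rfl), ← h]
  exact Finset.sum_congr rfl fun k _ => mul_comm _ _

theorem Matrix.rank_map_le {K L m n : Type*} [Field K] [Field L] [Fintype m] [Fintype n]
    (A : Matrix m n K) (f : K →+* L) : (A.map f).rank ≤ A.rank := by
  obtain ⟨B, C, h⟩ := A.exists_eq_mul_of_rank
  have hmap : A.map f = B.map f * C.map f := by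
    rw [← Matrix.map_mul, ← h]
  rw [hmap]
  exact (Matrix.rank_mul_le_left _ _).trans
    ((Matrix.rank_le_card_width _).trans_eq (Fintype.card_fin _))

/-- The substitution `X j ↦ ∑ i, P j i * X i`. -/
noncomputable def linearSubst {R ι : Type*} [CommRing R] [Fintype ι] (P : Matrix ι ι R) :
    MvPolynomial ι R →ₐ[R] MvPolynomial ι R :=
  MvPolynomial.aeval fun j => ∑ i, P j i • MvPolynomial.X i

theorem linearSubst_X {R ι : Type*} [CommRing R] [Fintype ι] (P : Matrix ι ι R) (j : ι) :
    linearSubst P (MvPolynomial.X j) = ∑ i, P j i • MvPolynomial.X i :=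
  MvPolynomial.aeval_X _ _

theorem linearSubst_comp {R ι : Type*} [CommRing R] [Fintype ι] (P Q : Matrix ι ι R) :
    (linearSubst Q).comp (linearSubst P) = linearSubst (P * Q) := by
  refine MvPolynomial.algHom_ext fun j => ?_
  simp only [AlgHom.comp_apply, linearSubst_X, map_sum, map_smul, Matrix.mul_apply,
    Finset.smul_sum, Finset.sum_smul, smul_smul]
  exact Finset.sum_comm

theorem linearSubst_one {R ι : Type*} [CommRing R] [Fintype ι] [DecidableEq ι] :
    linearSubst (1 : Matrix ι ι R) = AlgHom.id R _ := by
  refine MvPolynomial.algHom_ext fun j => ?_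
  simp [linearSubst_X, Matrix.one_apply]

theorem linearSubst_injective {R ι : Type*} [CommRing R] [Fintype ι] [DecidableEq ι]
    {P Q : Matrix ι ι R} (h : P * Q = 1) : Function.Injective (linearSubst P) := by
  refine Function.LeftInverse.injective (g := linearSubst Q) fun p => ?_
  rw [← AlgHom.comp_apply, linearSubst_comp, h, linearSubst_one, AlgHom.id_apply]

theorem LinearIndependent.eq_of_sum_smul_eq {R V ι : Type*} [Ring R] [AddCommGroup V]
    [Module R V] [Fintype ι] {v : ι → V} (hv : LinearIndependent R v) {f g : ι → R}
    (h : ∑ i, f i • v i = ∑ i, g i • v i) : f = g := by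
  funext i
  refine sub_eq_zero.mp (Fintype.linearIndependent_iff.mp hv (fun i => f i - g i) ?_ i)
  simp [sub_smul, h]

/-- The generic matrix `∑ i, X i • N i` over the field of rational functions. -/
noncomputable abbrev genericMatrix {ι m n : Type*} [Fintype ι] (N : ι → Matrix m n ℚ) :
    Matrix m n (FractionRing (MvPolynomial ι ℚ)) :=
  ∑ i, algebraMap (MvPolynomial ι ℚ) (FractionRing (MvPolynomial ι ℚ)) (MvPolynomial.X i) •
    (N i).map (algebraMap ℚ (FractionRing (MvPolynomial ι ℚ)))

theorem rank_genericMatrix_le {ι m n : Type*} [Fintype ι] [DecidableEq ι] [Fintype m]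
    [Fintype n] {N N' : ι → Matrix m n ℚ} {P Q : Matrix ι ι ℚ} (hPQ : P * Q = 1)
    (hN : ∀ i, N i = ∑ j, P j i • N' j) :
    (genericMatrix N).rank ≤ (genericMatrix N').rank := by
  let f : FractionRing (MvPolynomial ι ℚ) →+* FractionRing (MvPolynomial ι ℚ) :=
    IsFractionRing.map (j := (linearSubst P).toRingHom) (linearSubst_injective hPQ)
  have hf (p : MvPolynomial ι ℚ) : f (algebraMap _ _ p) = algebraMap _ _ (linearSubst P p) :=
    IsLocalization.map_eq _ p
  have h : (genericMatrix N').map f = genericMatrix N := by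
    ext a b
    simp only [Matrix.map_apply, Matrix.sum_apply, Matrix.smul_apply, smul_eq_mul, map_sum,
      map_mul, hf, linearSubst_X, hN, Algebra.smul_def, Finset.sum_mul, Finset.mul_sum,
      eq_ratCast, map_ratCast]
    rw [Finset.sum_comm]
    exact Finset.sum_congr rfl fun i _ => Finset.sum_congr rfl fun j _ => by
      rw [← IsScalarTower.algebraMap_apply, eq_ratCast]
      ring
  exact h ▸ Matrix.rank_map_le _ f

theorem rank_genericMatrix_le_of_span_eq {F ι m n : Type*} [Field F] [CharZero F] [Fintype ι]
    [Fintype m] [Fintype n] {ℓ ℓ' : ι → F} {N N' : ι → Matrix m n ℚ}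
    (hℓ : LinearIndependent ℚ ℓ) (hℓ' : LinearIndependent ℚ ℓ')
    (hspan : Submodule.span ℚ (Set.range ℓ) = Submodule.span ℚ (Set.range ℓ'))
    (hM : ∑ i, ℓ i • (N i).map (algebraMap ℚ F) = ∑ i, ℓ' i • (N' i).map (algebraMap ℚ F)) :
    (genericMatrix N).rank ≤ (genericMatrix N').rank := by
  classical
  have hP (j : ι) : ∃ c : ι → ℚ, ∑ i, c i • ℓ i = ℓ' j :=
    (Submodule.mem_span_range_iff_exists_fun ℚ).mp
      (hspan ▸ Submodule.subset_span ⟨j, rfl⟩)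
  have hQ (j : ι) : ∃ c : ι → ℚ, ∑ i, c i • ℓ' i = ℓ j :=
    (Submodule.mem_span_range_iff_exists_fun ℚ).mp
      (hspan ▸ Submodule.subset_span ⟨j, rfl⟩)
  choose P hP using hP
  choose Q hQ using hQ
  have hPQ : Matrix.of P * Matrix.of Q = 1 := by
    ext j k
    refine congrFun (hℓ'.eq_of_sum_smul_eq (f := (Matrix.of P * Matrix.of Q) j)
      (g := (1 : Matrix ι ι ℚ) j) ?_) k
    simp only [Matrix.mul_apply, Matrix.of_apply, Finset.sum_smul, Matrix.one_apply, ite_smul,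
      one_smul, zero_smul, Finset.sum_ite_eq, Finset.mem_univ, if_true]
    rw [Finset.sum_comm]
    simp only [mul_smul, ← Finset.smul_sum, hQ, hP]
  refine rank_genericMatrix_le hPQ fun i => ?_
  ext a b
  refine congrFun (hℓ.eq_of_sum_smul_eq (f := fun i => N i a b)
    (g := fun i => (∑ j, Matrix.of P j i • N' j) a b) ?_) i
  have hab := congrFun (congrFun hM a) b
  simp only [Matrix.sum_apply, Matrix.smul_apply, Matrix.map_apply, smul_eq_mul,
    mul_comm _ (algebraMap ℚ F _), ← Algebra.smul_def] at hab
  simp only [Matrix.sum_apply, Matrix.smul_apply, Matrix.of_apply, smul_eq_mul,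
    Finset.sum_smul, hab]
  rw [Finset.sum_comm]
  simp only [mul_comm (P _ _), mul_smul, ← Finset.smul_sum, hP]


/-- Well-definedness of the structural rank: if `ℓ` and `ℓ'` are two ℚ-bases of the
ℚ-span of the entries of `M`, with corresponding decompositions
`M = ∑ ℓᵢ Nᵢ = ∑ ℓ'ᵢ N'ᵢ` (`Nᵢ, N'ᵢ` rational matrices), then the generic matrices
`∑ Xᵢ Nᵢ` and `∑ Xᵢ N'ᵢ` have the same rank over `K_t = Frac(ℚ[X₁,…,X_t])`. -/
theorem structural_rank_well_defined (F : Type*) [Field F] [CharZero F] (m n t : ℕ)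
    (M : Matrix (Fin m) (Fin n) F)
    (ℓ ℓ' : Fin t → F) (N N' : Fin t → Matrix (Fin m) (Fin n) ℚ)
    (hℓ : LinearIndependent ℚ ℓ) (hℓ' : LinearIndependent ℚ ℓ')
    (hspan : Submodule.span ℚ (Set.range ℓ) =
      Submodule.span ℚ (Set.range fun p : Fin m × Fin n => M p.1 p.2))
    (hspan' : Submodule.span ℚ (Set.range ℓ') =
      Submodule.span ℚ (Set.range fun p : Fin m × Fin n => M p.1 p.2))
    (hM : M = ∑ i, ℓ i • (N i).map (algebraMap ℚ F))
    (hM' : M = ∑ i, ℓ' i • (N' i).map (algebraMap ℚ F)) :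
    (∑ i, algebraMap (MvPolynomial (Fin t) ℚ)
          (FractionRing (MvPolynomial (Fin t) ℚ)) (MvPolynomial.X i) •
        (N i).map (algebraMap ℚ (FractionRing (MvPolynomial (Fin t) ℚ)))).rank =
      (∑ i, algebraMap (MvPolynomial (Fin t) ℚ)
            (FractionRing (MvPolynomial (Fin t) ℚ)) (MvPolynomial.X i) •
          (N' i).map (algebraMap ℚ (FractionRing (MvPolynomial (Fin t) ℚ)))).rank := by
  have h := hspan.trans hspan'.symm
  have hMM' := hM.symm.trans hM'
  exact le_antisymm (rank_genericMatrix_le_of_span_eq hℓ hℓ' h hMM')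
    (rank_genericMatrix_le_of_span_eq hℓ' hℓ h.symm hMM'.symm)
end

section
/- Let F be a field of characteristic zero, let m, n, t be natural numbers, and let M be an m × n matrix over F whose m·n entries, viewed as a family of elements of F indexed by Fin m × Fin n, are linearly independent over ℚ. Let ℓ : Fin t → F be linearly independent over ℚ with ℚ-span equal to the ℚ-span of the set of entries of M, and let N : Fin t → (m × n matrices over ℚ) satisfy M = Σ_{i=1}^t ℓ_i · (N_i mapped entrywise into F). Then the rank over K_t of the matrix Σ_{i=1}^t X_i · (N_i mapped entrywise into K_t) equals min(m, n). -/
/-- A matrix over a field with linearly independent rows defines a surjective linear map. -/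
theorem Matrix.mulVec_surjective_of_linearIndependent_row {K ι κ : Type*} [Field K]
    [Fintype ι] [Fintype κ] (A : Matrix ι κ K) (h : LinearIndependent K A.row) :
    Function.Surjective A.mulVec := by
  have hr : A.rank = Fintype.card ι := h.rank_matrix
  have htop : LinearMap.range A.mulVecLin = ⊤ :=
    Submodule.eq_top_of_finrank_eq (by rw [Module.finrank_pi]; exact hr)
  exact LinearMap.range_eq_top.mp htop

/-- A matrix over a domain `R` with a square submatrix that a ring homomorphism specializes to the
identity has rank at least the size of that submatrix over any field containing `R`. -/
theorem Matrix.card_le_rank_map_of_map_submatrix_eq_one {R S K m n k : Type*} [CommRing R]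
    [CommRing S] [Nontrivial S] [Field K] [Fintype m] [Fintype n] [Fintype k] [DecidableEq k]
    (P : Matrix m n R) (φ : R →+* S) (ψ : R →+* K) (hψ : Function.Injective ψ)
    (f : k → m) (g : k → n) (h : (P.submatrix f g).map φ = 1) :
    Fintype.card k ≤ (P.map ψ).rank := by
  have hdet : (P.submatrix f g).det ≠ 0 := by
    intro h0
    have h1 := φ.map_det (P.submatrix f g)
    rw [h0, map_zero, RingHom.mapMatrix_apply, h, Matrix.det_one] at h1
    exact zero_ne_one h1
  have hunit : IsUnit ((P.map ψ).submatrix f g) := by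
    rw [Matrix.isUnit_iff_isUnit_det, isUnit_iff_ne_zero, Matrix.submatrix_map,
      ← RingHom.mapMatrix_apply, ← RingHom.map_det]
    exact (map_ne_zero_iff ψ hψ).mpr hdet
  rw [← Matrix.rank_of_isUnit _ hunit]
  exact Matrix.rank_submatrix_le _ _ _

/-- If the entries of `∑ ℓᵢ Nᵢ` are linearly independent over `K`, then every matrix over `K` is a
`K`-linear combination of the `Nᵢ`. -/
theorem Matrix.exists_sum_smul_eq_of_linearIndependent_entries {K F m n ι : Type*} [Field K]
    [Field F] [Algebra K F] [Fintype m] [Fintype n] [Fintype ι] (M : Matrix m n F)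
    (hind : LinearIndependent K (fun p : m × n => M p.1 p.2))
    (ℓ : ι → F) (N : ι → Matrix m n K)
    (hM : M = ∑ i, ℓ i • (N i).map (algebraMap K F)) (E : Matrix m n K) :
    ∃ x : ι → K, ∑ i, x i • N i = E := by
  let A : Matrix (m × n) ι K := Matrix.of fun p i => N i p.1 p.2
  have hA : LinearIndependent K A.row := by
    refine LinearIndependent.of_comp (Fintype.linearCombination K ℓ) ?_
    convert hind using 1
    funext p
    rw [Function.comp_apply, Fintype.linearCombination_apply, hM]
    simp [A, Matrix.row, Matrix.sum_apply, Algebra.smul_def, mul_comm]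
  obtain ⟨x, hx⟩ := A.mulVec_surjective_of_linearIndependent_row hA fun p => E p.1 p.2
  refine ⟨x, ?_⟩
  ext a b
  have := congrFun hx (a, b)
  simpa [A, Matrix.mulVec, dotProduct, Matrix.sum_apply, mul_comm] using this


/-- If the entries of `M` are ℚ-linearly independent, then the structural rank of `M`
— i.e. the rank over `K_t = Frac(ℚ[X₁,…,X_t])` of the generic matrix `∑ Xᵢ Nᵢ`
attached to any ℚ-basis `ℓ` of the span of the entries with `M = ∑ ℓᵢ Nᵢ` —
equals `min m n`. -/
theorem structural_rank_of_linearIndependent_entries (F : Type*) [Field F] [CharZero F]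
    (m n t : ℕ) (M : Matrix (Fin m) (Fin n) F)
    (hind : LinearIndependent ℚ (fun p : Fin m × Fin n => M p.1 p.2))
    (ℓ : Fin t → F) (N : Fin t → Matrix (Fin m) (Fin n) ℚ)
    (hℓ : LinearIndependent ℚ ℓ)
    (hspan : Submodule.span ℚ (Set.range ℓ) =
      Submodule.span ℚ (Set.range fun p : Fin m × Fin n => M p.1 p.2))
    (hM : M = ∑ i, ℓ i • (N i).map (algebraMap ℚ F)) :
    (∑ i, algebraMap (MvPolynomial (Fin t) ℚ)
          (FractionRing (MvPolynomial (Fin t) ℚ)) (MvPolynomial.X i) •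
        (N i).map (algebraMap ℚ (FractionRing (MvPolynomial (Fin t) ℚ)))).rank
      = min m n := by
  refine le_antisymm (le_min (Matrix.rank_le_height _) (Matrix.rank_le_width _)) ?_
  obtain ⟨x, hx⟩ := Matrix.exists_sum_smul_eq_of_linearIndependent_entries M hind ℓ N hM
    (Matrix.of fun a b => if (a : ℕ) = b then 1 else 0)
  have key := Matrix.card_le_rank_map_of_map_submatrix_eq_one
    (∑ i, (MvPolynomial.X i : MvPolynomial (Fin t) ℚ) • (N i).map MvPolynomial.C)
    (MvPolynomial.eval x)
    (algebraMap (MvPolynomial (Fin t) ℚ) (FractionRing (MvPolynomial (Fin t) ℚ)))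
    (IsFractionRing.injective _ _)
    (Fin.castLE (min_le_left m n)) (Fin.castLE (min_le_right m n)) (by
      ext a b
      have := congrFun (congrFun hx (Fin.castLE (min_le_left m n) a))
        (Fin.castLE (min_le_right m n) b)
      simpa [Matrix.sum_apply, Matrix.one_apply, Fin.ext_iff] using this)
  rw [Fintype.card_fin] at key
  refine key.trans_eq (congrArg Matrix.rank ?_)
  ext a b
  have hC (q : ℚ) : algebraMap (MvPolynomial (Fin t) ℚ)
      (FractionRing (MvPolynomial (Fin t) ℚ)) (MvPolynomial.C q) = q :=
    eq_ratCast ((algebraMap (MvPolynomial (Fin t) ℚ)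
      (FractionRing (MvPolynomial (Fin t) ℚ))).comp MvPolynomial.C) q
  simp [Matrix.sum_apply, Algebra.smul_def, hC]
end

section
/- Let E be a field of characteristic zero (hence a ℚ-algebra in a unique way) admitting a ring homomorphism σ : E → ℝ. Then there is no ℝ-linear endomorphism J of the commutative ring E ⊗_ℚ ℝ (viewed as an ℝ-vector space via the second tensor factor) such that J(J(v)) = −v for all v ∈ E ⊗_ℚ ℝ and J((e ⊗ 1) · v) = (e ⊗ 1) · J(v) for all e ∈ E and v ∈ E ⊗_ℚ ℝ. -/
open scoped TensorProduct

/- `E ⊗[ℚ] ℝ` is viewed as an ℝ-vector space via the second tensor factor. -/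
attribute [local instance] Algebra.TensorProduct.rightAlgebra

/-- If a field `E` of characteristic zero admits a ring homomorphism to `ℝ` (a real
embedding), then there is no ℝ-linear endomorphism `J` of `E ⊗_ℚ ℝ` (ℝ acting through
the second tensor factor) with `J ∘ J = -id` commuting with the action of `E` through
the first tensor factor. -/
theorem no_complex_structure_of_real_embedding (E : Type*) [Field E] [CharZero E]
    (σ : E →+* ℝ) :
    ¬ ∃ J : (E ⊗[ℚ] ℝ) →ₗ[ℝ] (E ⊗[ℚ] ℝ),
        (∀ v : E ⊗[ℚ] ℝ, J (J v) = -v) ∧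
        (∀ (e : E) (v : E ⊗[ℚ] ℝ), J ((e ⊗ₜ[ℚ] 1) * v) = (e ⊗ₜ[ℚ] 1) * J v) := by
  rintro ⟨J, hJ, hE⟩
  have hmul : ∀ w : E ⊗[ℚ] ℝ, J w = w * J 1 := by
    intro w
    induction w using TensorProduct.induction_on with
    | zero => simp
    | tmul e r =>
      have h : e ⊗ₜ[ℚ] r = (e ⊗ₜ[ℚ] (1 : ℝ)) * (r • (1 : E ⊗[ℚ] ℝ)) := by
        rw [Algebra.smul_def, Algebra.TensorProduct.right_algebraMap_apply]
        simp
      rw [h, hE, map_smul, mul_assoc, smul_mul_assoc, one_mul]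
    | add x y hx hy => rw [map_add, hx, hy, add_mul]
  have hsq : J 1 * J 1 = -1 := by rw [← hmul, hJ]
  let φ : E ⊗[ℚ] ℝ →ₐ[ℚ] ℝ :=
    Algebra.TensorProduct.productMap σ.toRatAlgHom (AlgHom.id ℚ ℝ)
  have h := congrArg φ hsq
  rw [map_mul, map_neg, map_one φ] at h
  linarith [mul_self_nonneg (φ (J 1))]
end
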